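/- Given rational subsets S, T ⊆ Γ* × ℕ^Λ, the set S ⊗ T = {(w, m1 + m2) : (w, m1) ∈ S, (w, m2) ∈ T} is rational, and an automaton recognizing it can be effectively constructed from automata for S and T. -/

import Mathlib

/-!
Formalization of context-bounded liveness for dynamic networks of concurrent
pushdown systems (DCPS) and VASS with balloons (VASSB).
Global states, stack symbols, places, balloon states etc. are drawn from ℕ;
the finite components of the systems are recorded as `Finset`s.
-/

noncomputable section

namespace CBL

/-! ### Vectors over a finite output alphabet -/

/-- A vector in `ℕ^Λ` (finitely supported, letters drawn from `ℕ`). -/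
abbrev Vec : Type := ℕ →₀ ℕ

def encodeVec (v : Vec) : ℕ := Encodable.encode v.graph.val

/-! ### Pushdown automata with output and rational subsets of `Γ* × ℕ^Λ` -/

/-- Stack action of an edge: `none` is `ε`, `some (false, γ)` pushes `γ`,
`some (true, γ)` pops `γ` (i.e. reads `γ̄`). -/
abbrev PLabel : Type := Option (Bool × ℕ)

/-- A pushdown automaton with output `(Q, Γ, Λ, E, q0, q_f)`. -/
structure PDAO where
  states : Finset ℕ
  alph : Finset ℕ
  out : Finset ℕ
  edges : Finset (ℕ × PLabel × Vec × ℕ)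
  q0 : ℕ
  qf : ℕ

/-- A configuration `(q, w, m)` of a pushdown automaton with output. -/
abbrev PConf : Type := ℕ × List ℕ × Vec

/-- One step of the pushdown automaton with output `A`. -/
def PStep (A : PDAO) (c c' : PConf) : Prop :=
  ∃ e ∈ A.edges, c.1 = e.1 ∧ c'.1 = e.2.2.2 ∧ c'.2.2 = c.2.2 + e.2.2.1 ∧
    (match e.2.1 with
     | none => c'.2.1 = c.2.1
     | some (false, gam) => c'.2.1 = c.2.1 ++ [gam]
     | some (true, gam) => c.2.1 = c'.2.1 ++ [gam])

def PReach (A : PDAO) : PConf → PConf → Prop := Relation.ReflTransGen (PStep A)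

/-- `S_{A,q} = {(w, m) : (q0, ε, 0) →* (q, w, m') →* (q_f, ε, m)}`. -/
def SSet (A : PDAO) (q : ℕ) : Set (List ℕ × Vec) :=
  {wm | ∃ m' : Vec, PReach A (A.q0, [], 0) (q, wm.1, m') ∧
        PReach A (q, wm.1, m') (A.qf, [], wm.2)}

/-- `I_{A,q} = {(w, m) : (q0, ε, 0) →* (q, w, m)}`. -/
def ISet (A : PDAO) (q : ℕ) : Set (List ℕ × Vec) :=
  {wm | PReach A (A.q0, [], 0) (q, wm.1, wm.2)}

/-- A finite automaton over `Γ* × ℕ^Λ`: edges are labelled by pairs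
`(u, m) ∈ Γ* × ℕ^Λ`. -/
structure RatAut where
  states : Finset ℕ
  edges : Finset (ℕ × (List ℕ × Vec) × ℕ)
  q0 : ℕ
  final : Finset ℕ

/-- One step of the automaton: concatenate the word label, add the vector
label. -/
def RStep (B : RatAut) (c c' : ℕ × List ℕ × Vec) : Prop :=
  ∃ e ∈ B.edges, c.1 = e.1 ∧ c'.1 = e.2.2 ∧
    c'.2.1 = c.2.1 ++ e.2.1.1 ∧ c'.2.2 = c.2.2 + e.2.1.2

/-- The set of labels of accepting runs of `B`; a subset of `Γ* × ℕ^Λ` is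
rational iff it is of this form. -/
def RLang (B : RatAut) : Set (List ℕ × Vec) :=
  {wm | ∃ qf ∈ B.final, Relation.ReflTransGen (RStep B) (B.q0, [], 0) (qf, wm.1, wm.2)}

/-- An effective encoding of pushdown automata with output. -/
def encodePDAO (A : PDAO) : ℕ :=
  Encodable.encode (A.states.val, A.alph.val, A.out.val,
    A.edges.val.map (fun e => (e.1, Encodable.encode e.2.1, encodeVec e.2.2.1, e.2.2.2)),
    A.q0, A.qf)

/-- An effective encoding of finite automata over `Γ* × ℕ^Λ`. -/
def encodeRatAut (B : RatAut) : ℕ :=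
  Encodable.encode (B.states.val,
    B.edges.val.map (fun e => (e.1, e.2.1.1, encodeVec e.2.1.2, e.2.2)),
    B.q0, B.final.val)

/-! ### Encodings of finite sets as sorted lists -/

/-- The strictly increasing list with the same members as `L`. -/
def sortDedup (L : List ℕ) : List ℕ := (List.range (L.sum + 1)).filter (· ∈ L)

theorem mem_sortDedup {L : List ℕ} {a : ℕ} : a ∈ sortDedup L ↔ a ∈ L := by
  simp only [sortDedup, List.mem_filter, List.mem_range, decide_eq_true_eq, and_iff_right_iff_imp]
  intro h
  have := List.le_sum_of_mem h
  omega

theorem sortDedup_pairwise (L : List ℕ) : (sortDedup L).Pairwise (· < ·) :=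
  List.pairwise_lt_range.filter _

theorem primrec_sortDedup : Primrec sortDedup := by
  have hsum : Primrec (fun L : List ℕ => L.sum) :=
    (Primrec.list_foldr (h := fun _ p => p.1 + p.2) Primrec.id (Primrec.const 0)
      (Primrec.nat_add.comp (Primrec.fst.comp Primrec.snd) (Primrec.snd.comp Primrec.snd)).to₂).of_eq
      fun L => by simp [List.sum_eq_foldr]
  have hmem : PrimrecRel fun (a : ℕ) (L : List ℕ) => a ∈ L :=
    ((PrimrecRel.exists_mem_list (R := fun a b : ℕ => a = b) Primrec.eq).comp
      Primrec.snd Primrec.fst).of_eq fun p => by simp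
  exact ((PrimrecRel.listFilter hmem).comp
    (Primrec.list_range.comp (Primrec.succ.comp hsum)) Primrec.id).of_eq fun L => by
      simp [sortDedup]

theorem encode_map_encode {α : Type*} [Encodable α] (l : List α) :
    Encodable.encode (l.map Encodable.encode) = Encodable.encode l := by
  induction l with
  | nil => simp
  | cons a l ih => simp [ih]

theorem exists_encode_multiset_eq {α : Type*} [Encodable α] (s : Multiset α) :
    ∃ l : List α, (l : Multiset α) = s ∧ Encodable.encode s = Encodable.encode l ∧
      l.Pairwise (fun a b => Encodable.encode a ≤ Encodable.encode b) := by
  let r : α → α → Prop := fun a b => Encodable.encode a ≤ Encodable.encode b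
  have htrans : IsTrans α r := ⟨fun _ _ _ => le_trans⟩
  have hanti : Std.Antisymm r :=
    ⟨fun _ _ h h' => Encodable.encode_injective (le_antisymm h h')⟩
  have htotal : Std.Total r := ⟨fun _ _ => le_total _ _⟩
  refine ⟨_, ?_, rfl, ?_⟩
  · exact @Multiset.sort_eq _ s _ _ htrans hanti htotal
  · exact @Multiset.pairwise_sort _ s _ _ htrans hanti htotal

theorem encode_finset_map {σ τ : Type*} [Encodable τ] {g : σ → τ} (hg : Function.Injective g)
    (s : Finset σ) (L : List σ) (h : ∀ x, x ∈ s ↔ x ∈ L) :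
    Encodable.encode (s.val.map g) =
      Encodable.encode (sortDedup ((L.map g).map Encodable.encode)) := by
  obtain ⟨l, hl, he, hs⟩ := exists_encode_multiset_eq (s.val.map g)
  rw [he, ← encode_map_encode l]
  congr 1
  have hnd : l.Nodup := by
    rw [← Multiset.coe_nodup, hl]
    exact s.nodup.map hg
  have hmem : ∀ x, x ∈ l ↔ x ∈ L.map g := fun x => by
    rw [← Multiset.mem_coe, hl]
    simp [h]
  refine List.Perm.eq_of_pairwise (le := (· ≤ ·)) (fun _ _ _ _ => le_antisymm)
    (List.pairwise_map.2 hs) ((sortDedup_pairwise _).imp le_of_lt) ?_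
  refine (List.perm_ext_iff_of_nodup (hnd.map Encodable.encode_injective)
    ((sortDedup_pairwise _).imp ne_of_lt)).2 fun a => ?_
  simp only [mem_sortDedup, List.mem_map, hmem]

theorem exists_list_encode_map {σ τ : Type*} [Encodable τ] (g : σ → τ) (s : Finset σ) :
    ∃ L : List σ, (∀ x, x ∈ s ↔ x ∈ L) ∧
      Encodable.encode (s.val.map g) = Encodable.encode (L.map g) := by
  obtain ⟨l, hl, he, -⟩ := exists_encode_multiset_eq (s.val.map g)
  have hp : l.Perm (s.toList.map g) := by
    rw [← Multiset.coe_eq_coe, hl, ← Multiset.map_coe, Finset.coe_toList]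
  obtain ⟨L, hL, hLp⟩ := (congrFun (congrFun (List.eq_map_comp_perm g) l) s.toList).mpr hp
  exact ⟨L, fun x => by rw [hLp.mem_iff, Finset.mem_toList], by rw [he, ← hL]⟩

theorem encodeVec_injective : Function.Injective encodeVec := fun _ _ h =>
  Finsupp.graph_injective _ _ (Finset.val_injective (Encodable.encode_injective h))

/-! ### The product construction -/

/-- Edges `(source, word, vector, target)` with vectors represented in `V`. -/
abbrev Edge (V : Type) : Type := ℕ × List ℕ × V × ℕ

/-- A state of one factor together with the part of the word of the last edge that is still to be
read. -/
abbrev HalfConf : Type := ℕ × List ℕ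

def pairState (s t : HalfConf) : ℕ := Encodable.encode (s, t)

theorem pairState_inj {s t s' t' : HalfConf} :
    pairState s t = pairState s' t' ↔ s = s' ∧ t = t' := by
  simp only [pairState, Encodable.encode_inj, Prod.mk.injEq]

def halfConfs {V : Type} (q : ℕ) (E : List (Edge V)) : List HalfConf :=
  (q, []) :: E.flatMap fun e =>
    (List.range (e.2.1.length + 1)).map fun i => (e.2.2.2, e.2.1.drop i)

/-- The edges of the product of two automata: either factor starts one of its edges once the word
of its previous edge is used up, and the words of the two current edges are read synchronously,
letter by letter. -/
def prodEdges {V : Type} (z : V) (q₁ q₂ : ℕ) (E₁ E₂ : List (Edge V)) : List (Edge V) :=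
  (E₁.flatMap fun e => (halfConfs q₂ E₂).map fun h =>
    (pairState (e.1, []) h, [], e.2.2.1, pairState (e.2.2.2, e.2.1) h)) ++
  (E₂.flatMap fun e => (halfConfs q₁ E₁).map fun h =>
    (pairState h (e.1, []), [], e.2.2.1, pairState h (e.2.2.2, e.2.1))) ++
  (halfConfs q₁ E₁).flatMap fun g => (halfConfs q₂ E₂).flatMap fun h =>
    (E₁.flatMap fun e => e.2.1).map fun a =>
      (pairState (g.1, a :: g.2) (h.1, a :: h.2), [a], z, pairState g h)

def prodFinal (F₁ F₂ : List ℕ) : List ℕ :=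
  F₁.flatMap fun a => F₂.map fun b => pairState (a, []) (b, [])

def prodStates {V : Type} (E : List (Edge V)) (q : ℕ) (F : List ℕ) : List ℕ :=
  q :: (F ++ E.flatMap fun e => [e.1, e.2.2.2])

/-- Replace the vector of an edge. -/
def Edge.map {V W : Type} (f : V → W) (e : Edge V) : Edge W := (e.1, e.2.1, f e.2.2.1, e.2.2.2)

theorem Edge.map_injective {V W : Type} {f : V → W} (hf : Function.Injective f) :
    Function.Injective (Edge.map f) := by
  rintro ⟨a, b, c, d⟩ ⟨a', b', c', d'⟩ h
  simp only [Edge.map, Prod.mk.injEq] at h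
  obtain ⟨rfl, rfl, h, rfl⟩ := h
  rw [hf h]

theorem halfConfs_map {V W : Type} (f : V → W) (q : ℕ) (E : List (Edge V)) :
    halfConfs q (E.map (Edge.map f)) = halfConfs q E := by
  simp [halfConfs, List.flatMap_map, Edge.map]

theorem prodEdges_map {V W : Type} (f : V → W) (z : V) (q₁ q₂ : ℕ) (E₁ E₂ : List (Edge V)) :
    prodEdges (f z) q₁ q₂ (E₁.map (Edge.map f)) (E₂.map (Edge.map f)) =
      (prodEdges z q₁ q₂ E₁ E₂).map (Edge.map f) := by
  simp [prodEdges, halfConfs_map, List.flatMap_map, List.map_flatMap, Edge.map, Function.comp_def]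

theorem prodStates_map {V W : Type} (f : V → W) (E : List (Edge V)) (q : ℕ) (F : List ℕ) :
    prodStates (E.map (Edge.map f)) q F = prodStates E q F := by
  simp [prodStates, List.flatMap_map, Edge.map]

/-! ### Computability of the product construction -/

theorem primrec_pairState : Primrec₂ pairState :=
  Primrec.encode.comp Primrec.id

theorem primrec_halfConfs {V : Type} [Primcodable V] :
    Primrec₂ (halfConfs : ℕ → List (Edge V) → List HalfConf) := by
  unfold halfConfs
  refine Primrec.list_cons.comp (Primrec.fst.pair (Primrec.const [])) ?_
  refine Primrec.list_flatMap Primrec.snd ?_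
  refine Primrec.list_map (Primrec.list_range.comp (Primrec.succ.comp
    (Primrec.list_length.comp (Primrec.fst.comp (Primrec.snd.comp Primrec.snd))))) ?_
  have he : Primrec fun p : ((ℕ × List (Edge V)) × Edge V) × ℕ => p.1.2 :=
    Primrec.snd.comp Primrec.fst
  exact (Primrec.snd.comp (Primrec.snd.comp (Primrec.snd.comp he))).pair
    (Primrec.list_drop.comp Primrec.snd (Primrec.fst.comp (Primrec.snd.comp he)))

section Primrec

variable {α V : Type} [Primcodable α] [Primcodable V]

theorem primrec_mk_edge {s t : α → ℕ} {w : α → List ℕ} {v : α → V} (hs : Primrec s)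
    (hw : Primrec w) (hv : Primrec v) (ht : Primrec t) :
    Primrec fun a => ((s a, w a, v a, t a) : Edge V) :=
  hs.pair (hw.pair (hv.pair ht))

theorem primrec_prodEdges (z : V) {q₁ q₂ : α → ℕ} {E₁ E₂ : α → List (Edge V)}
    (hq₁ : Primrec q₁) (hq₂ : Primrec q₂) (hE₁ : Primrec E₁) (hE₂ : Primrec E₂) :
    Primrec fun a => prodEdges z (q₁ a) (q₂ a) (E₁ a) (E₂ a) := by
  have hH₁ : Primrec fun a => halfConfs (q₁ a) (E₁ a) := primrec_halfConfs.comp hq₁ hE₁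
  have hH₂ : Primrec fun a => halfConfs (q₂ a) (E₂ a) := primrec_halfConfs.comp hq₂ hE₂
  have hnil {β : Type} [Primcodable β] : Primrec fun _ : β => ([] : List ℕ) := Primrec.const []
  have he : Primrec fun p : (α × Edge V) × HalfConf => p.1.2 := Primrec.snd.comp Primrec.fst
  have hsrc := Primrec.fst.comp he
  have hwd := Primrec.fst.comp (Primrec.snd.comp he)
  have hvec := Primrec.fst.comp (Primrec.snd.comp (Primrec.snd.comp he))
  have htgt := Primrec.snd.comp (Primrec.snd.comp (Primrec.snd.comp he))
  have hh : Primrec fun p : (α × Edge V) × HalfConf => p.2 := Primrec.snd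
  unfold prodEdges
  refine Primrec.list_append.comp (Primrec.list_append.comp ?_ ?_) ?_
  · refine Primrec.list_flatMap hE₁ (Primrec.list_map (hH₂.comp Primrec.fst) ?_)
    exact primrec_mk_edge (primrec_pairState.comp (hsrc.pair hnil) hh) hnil hvec
      (primrec_pairState.comp (htgt.pair hwd) hh)
  · refine Primrec.list_flatMap hE₂ (Primrec.list_map (hH₁.comp Primrec.fst) ?_)
    exact primrec_mk_edge (primrec_pairState.comp hh (hsrc.pair hnil)) hnil hvec
      (primrec_pairState.comp hh (htgt.pair hwd))
  · refine Primrec.list_flatMap hH₁ (Primrec.list_flatMap (hH₂.comp Primrec.fst) ?_)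
    refine Primrec.list_map (Primrec.list_flatMap
      (hE₁.comp (Primrec.fst.comp Primrec.fst))
      (Primrec.fst.comp (Primrec.snd.comp Primrec.snd))) ?_
    have hg : Primrec fun p : ((α × HalfConf) × HalfConf) × ℕ => p.1.1.2 :=
      Primrec.snd.comp (Primrec.fst.comp Primrec.fst)
    have hh' : Primrec fun p : ((α × HalfConf) × HalfConf) × ℕ => p.1.2 :=
      Primrec.snd.comp Primrec.fst
    have ha : Primrec fun p : ((α × HalfConf) × HalfConf) × ℕ => p.2 := Primrec.snd
    exact primrec_mk_edge
      (primrec_pairState.comp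
        ((Primrec.fst.comp hg).pair (Primrec.list_cons.comp ha (Primrec.snd.comp hg)))
        ((Primrec.fst.comp hh').pair (Primrec.list_cons.comp ha (Primrec.snd.comp hh'))))
      (Primrec.list_cons.comp ha hnil) (Primrec.const z) (primrec_pairState.comp hg hh')

theorem primrec_prodFinal : Primrec₂ prodFinal := by
  unfold prodFinal
  refine Primrec.list_flatMap Primrec.fst
    (Primrec.list_map (Primrec.snd.comp Primrec.fst) ?_)
  exact primrec_pairState.comp
    ((Primrec.snd.comp Primrec.fst).pair (Primrec.const [])) (Primrec.snd.pair (Primrec.const []))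

theorem primrec_prodStates {E : α → List (Edge V)} {q : α → ℕ} {F : α → List ℕ}
    (hE : Primrec E) (hq : Primrec q) (hF : Primrec F) :
    Primrec fun a => prodStates (E a) (q a) (F a) := by
  unfold prodStates
  refine Primrec.list_cons.comp hq (Primrec.list_append.comp hF (Primrec.list_flatMap hE ?_))
  exact Primrec.list_cons.comp (Primrec.fst.comp Primrec.snd) (Primrec.list_cons.comp
    (Primrec.snd.comp (Primrec.snd.comp (Primrec.snd.comp Primrec.snd))) (Primrec.const []))

end Primrec

/-! ### Correctness of the product construction -/

/-- `RunOf B k p w m q`: there is a run of `k` edges of `B` from `p` to `q` with label `(w, m)`. -/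
inductive RunOf (B : RatAut) : ℕ → ℕ → List ℕ → Vec → ℕ → Prop
  | nil (q : ℕ) : RunOf B 0 q [] 0 q
  | cons {k p q r : ℕ} {u w : List ℕ} {n m : Vec} (he : (p, (u, n), q) ∈ B.edges)
      (h : RunOf B k q w m r) : RunOf B (k + 1) p (u ++ w) (n + m) r

theorem RunOf.reach {B : RatAut} {k p q : ℕ} {w : List ℕ} {m : Vec} (h : RunOf B k p w m q) :
    ∀ (u : List ℕ) (n : Vec),
      Relation.ReflTransGen (RStep B) (p, u, n) (q, u ++ w, n + m) := by
  induction h with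
  | nil q => intro u n; simpa using Relation.ReflTransGen.refl
  | cons he _ ih =>
    intro u n
    refine Relation.ReflTransGen.head (b := (_, u ++ _, n + _)) ⟨_, he, rfl, rfl, rfl, rfl⟩ ?_
    rw [← List.append_assoc, ← add_assoc]
    exact ih _ _

theorem exists_runOf {B : RatAut} {c d : ℕ × List ℕ × Vec}
    (h : Relation.ReflTransGen (RStep B) c d) :
    ∃ k w m, RunOf B k c.1 w m d.1 ∧ d.2.1 = c.2.1 ++ w ∧ d.2.2 = c.2.2 + m := by
  induction h using Relation.ReflTransGen.head_induction_on with
  | refl => exact ⟨0, [], 0, .nil _, by simp, by simp⟩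
  | head hs _ ih =>
    obtain ⟨⟨p, ⟨u, n⟩, q⟩, he, h1, h2, h3, h4⟩ := hs
    obtain ⟨k, w, m, hr, hw, hm⟩ := ih
    refine ⟨k + 1, u ++ w, n + m, ?_, ?_, ?_⟩
    · rw [h1]
      rw [h2] at hr
      exact .cons he hr
    · rw [hw, h3, List.append_assoc]
    · rw [hm, h4, add_assoc]

/-- The edges of `B` are those in the list `E`. -/
def HasEdges (B : RatAut) (E : List (Edge Vec)) : Prop :=
  ∀ p u n q, (p, (u, n), q) ∈ B.edges ↔ (p, u, n, q) ∈ E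

theorem mem_halfConfs_start {V : Type} {q : ℕ} {E : List (Edge V)} {e : Edge V} (he : e ∈ E) :
    (e.2.2.2, e.2.1) ∈ halfConfs q E := by
  refine List.mem_cons_of_mem _ (List.mem_flatMap.2 ⟨e, he, List.mem_map.2 ⟨0, by simp, by simp⟩⟩)

theorem mem_halfConfs_tail {V : Type} {q p a : ℕ} {x : List ℕ} {E : List (Edge V)}
    (h : (p, a :: x) ∈ halfConfs q E) :
    (p, x) ∈ halfConfs q E ∧ a ∈ E.flatMap fun e => e.2.1 := by
  simp only [halfConfs, List.mem_cons, Prod.mk.injEq, reduceCtorEq, and_false, List.mem_flatMap,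
    List.mem_map, List.mem_range, false_or] at h
  obtain ⟨e, he, i, hi, rfl, hd⟩ := h
  have hlt : i < e.2.1.length := by
    by_contra hle
    rw [List.drop_eq_nil_of_le (by omega)] at hd
    simp at hd
  refine ⟨List.mem_cons_of_mem _ (List.mem_flatMap.2 ⟨e, he, List.mem_map.2 ⟨i + 1, ?_, ?_⟩⟩),
    List.mem_flatMap.2 ⟨e, he, List.mem_of_mem_drop (i := i) (by simp [hd])⟩⟩
  · simpa using hlt
  · rw [← List.tail_drop, hd, List.tail_cons]

section Product

variable {B B₁ B₂ : RatAut} {E₁ E₂ : List (Edge Vec)}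

theorem prod_sound (h₁ : HasEdges B₁ E₁) (h₂ : HasEdges B₂ E₂)
    (hB : HasEdges B (prodEdges 0 B₁.q0 B₂.q0 E₁ E₂)) {c : ℕ × List ℕ × Vec}
    (h : Relation.ReflTransGen (RStep B)
      (pairState (B₁.q0, []) (B₂.q0, []), [], 0) c) :
    ∃ (s t : HalfConf) (m₁ m₂ : Vec), c.1 = pairState s t ∧ c.2.2 = m₁ + m₂ ∧
      Relation.ReflTransGen (RStep B₁) (B₁.q0, [], 0) (s.1, c.2.1 ++ s.2, m₁) ∧
      Relation.ReflTransGen (RStep B₂) (B₂.q0, [], 0) (t.1, c.2.1 ++ t.2, m₂) := by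
  induction h with
  | refl => exact ⟨(_, []), (_, []), 0, 0, rfl, by simp, .refl, .refl⟩
  | @tail c d _ hs ih =>
    obtain ⟨s, t, m₁, m₂, hc, hm, r₁, r₂⟩ := ih
    obtain ⟨⟨p, ⟨u, n⟩, q⟩, he, e1, e2, e3, e4⟩ := hs
    rw [hB] at he
    simp only at e1 e2 e3 e4
    rw [hc] at e1
    rw [hm] at e4
    simp only [prodEdges, List.mem_append, List.mem_flatMap, List.mem_map, Prod.mk.injEq] at he
    rcases he with (⟨e, he, h, -, rfl, rfl, rfl, rfl⟩ | ⟨e, he, h, -, rfl, rfl, rfl, rfl⟩) |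
      ⟨g, -, h, -, a, -, rfl, rfl, rfl, rfl⟩
    · obtain ⟨rfl, rfl⟩ := pairState_inj.1 e1
      refine ⟨_, _, m₁ + e.2.2.1, m₂, e2, by rw [e4]; abel,
        r₁.tail ⟨_, (h₁ e.1 e.2.1 e.2.2.1 e.2.2.2).2 he, rfl, rfl, ?_, rfl⟩, ?_⟩
      · simp [e3]
      · simpa [e3] using r₂
    · obtain ⟨rfl, rfl⟩ := pairState_inj.1 e1
      refine ⟨_, _, m₁, m₂ + e.2.2.1, e2, by rw [e4]; abel, ?_,
        r₂.tail ⟨_, (h₂ e.1 e.2.1 e.2.2.1 e.2.2.2).2 he, rfl, rfl, ?_, rfl⟩⟩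
      · simpa [e3] using r₁
      · simp [e3]
    · obtain ⟨rfl, rfl⟩ := pairState_inj.1 e1
      exact ⟨_, _, m₁, m₂, e2, by rw [e4]; abel, by simpa [e3] using r₁, by simpa [e3] using r₂⟩

theorem prod_complete (h₁ : HasEdges B₁ E₁) (h₂ : HasEdges B₂ E₂)
    (hB : HasEdges B (prodEdges 0 B₁.q0 B₂.q0 E₁ E₂)) (N : ℕ) :
    ∀ {k₁ k₂ p q f₁ f₂ : ℕ} {x y w₁ w₂ : List ℕ} {m₁ m₂ : Vec},
      k₁ + k₂ + (x ++ w₁).length ≤ N →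
      (p, x) ∈ halfConfs B₁.q0 E₁ → (q, y) ∈ halfConfs B₂.q0 E₂ →
      RunOf B₁ k₁ p w₁ m₁ f₁ → RunOf B₂ k₂ q w₂ m₂ f₂ → x ++ w₁ = y ++ w₂ →
      ∃ k, RunOf B k (pairState (p, x) (q, y)) (x ++ w₁) (m₁ + m₂)
        (pairState (f₁, []) (f₂, [])) := by
  induction N with
  | zero =>
    intro k₁ k₂ p q f₁ f₂ x y w₁ w₂ m₁ m₂ hN _ _ r₁ r₂ hw
    cases r₁ with
    | cons => omega
    | nil =>
      cases r₂ with
      | cons => omega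
      | nil =>
        obtain rfl : x = [] := List.eq_nil_of_length_eq_zero (by simp at hN; simp [hN])
        obtain rfl : y = [] := by simpa using hw.symm
        exact ⟨0, by simpa using RunOf.nil _⟩
  | succ N ih =>
    intro k₁ k₂ p q f₁ f₂ x y w₁ w₂ m₁ m₂ hN hx hy r₁ r₂ hw
    have start₂ : y = [] → ∀ {k₂ r u w n m}, k₁ + k₂ + (x ++ w₁).length ≤ N →
        (q, (u, n), r) ∈ B₂.edges → RunOf B₂ k₂ r w m f₂ → x ++ w₁ = u ++ w →
        ∃ k, RunOf B k (pairState (p, x) (q, y)) (x ++ w₁) (m₁ + (n + m))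
          (pairState (f₁, []) (f₂, [])) := by
      rintro rfl k₂ r u w n m hN he hr hw
      rw [h₂] at he
      obtain ⟨k, hk⟩ := ih hN hx (mem_halfConfs_start he) r₁ hr hw
      refine ⟨k + 1, ?_⟩
      rw [add_left_comm]
      refine RunOf.cons (u := []) ((hB _ _ _ _).2 ?_) hk
      exact List.mem_append_left _ (List.mem_append_right _
        (List.mem_flatMap.2 ⟨_, he, List.mem_map.2 ⟨_, hx, rfl⟩⟩))
    cases x with
    | nil =>
      cases r₁ with
      | nil =>
        obtain rfl : y = [] := by
          by_contra hy'
          simp [hy'] at hw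
        cases r₂ with
        | nil => exact ⟨0, by simpa using RunOf.nil _⟩
        | cons he hr => exact start₂ rfl (by simp at hN ⊢; omega) he hr (by simpa using hw)
      | @cons k₁ _ r _ u w n m he hr =>
        rw [h₁] at he
        obtain ⟨k, hk⟩ := ih (by simp at hN ⊢; omega) (mem_halfConfs_start he) hy hr r₂
          (by simpa using hw)
        refine ⟨k + 1, ?_⟩
        rw [add_assoc]
        refine RunOf.cons (u := []) ((hB _ _ _ _).2 ?_) hk
        exact List.mem_append_left _ (List.mem_append_left _
          (List.mem_flatMap.2 ⟨_, he, List.mem_map.2 ⟨_, hy, rfl⟩⟩))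
    | cons a x =>
      cases y with
      | nil =>
        cases r₂ with
        | nil => simp at hw
        | cons he hr => exact start₂ rfl (by simp at hN ⊢; omega) he hr (by simpa using hw)
      | cons b y =>
        obtain ⟨rfl, hw'⟩ : a = b ∧ x ++ w₁ = y ++ w₂ := by simpa using hw
        obtain ⟨hx', ha⟩ := mem_halfConfs_tail hx
        obtain ⟨k, hk⟩ := ih (by simp at hN ⊢; omega) hx' (mem_halfConfs_tail hy).1 r₁ r₂ hw'
        refine ⟨k + 1, ?_⟩
        rw [← zero_add (m₁ + m₂)]
        refine RunOf.cons (u := [a]) ((hB _ _ _ _).2 ?_) hk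
        exact List.mem_append_right _ (List.mem_flatMap.2 ⟨_, hx', List.mem_flatMap.2
          ⟨_, (mem_halfConfs_tail hy).1, List.mem_map.2 ⟨a, ha, rfl⟩⟩⟩)

theorem rLang_prod (h₁ : HasEdges B₁ E₁) (h₂ : HasEdges B₂ E₂)
    (hB : HasEdges B (prodEdges 0 B₁.q0 B₂.q0 E₁ E₂))
    (hq : B.q0 = pairState (B₁.q0, []) (B₂.q0, []))
    (hF : ∀ x, x ∈ B.final ↔ ∃ a ∈ B₁.final, ∃ b ∈ B₂.final, pairState (a, []) (b, []) = x) :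
    RLang B = {wm : List ℕ × Vec | ∃ m1 m2 : Vec,
      (wm.1, m1) ∈ RLang B₁ ∧ (wm.1, m2) ∈ RLang B₂ ∧ wm.2 = m1 + m2} := by
  ext ⟨w, m⟩
  constructor
  · rintro ⟨f, hf, hr⟩
    rw [hq] at hr
    obtain ⟨a, ha, b, hb, rfl⟩ := (hF f).1 hf
    obtain ⟨s, t, m₁, m₂, hst, hm, r₁, r₂⟩ := prod_sound h₁ h₂ hB hr
    obtain ⟨rfl, rfl⟩ := pairState_inj.1 hst
    exact ⟨m₁, m₂, ⟨a, ha, by simpa using r₁⟩, ⟨b, hb, by simpa using r₂⟩, hm⟩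
  · rintro ⟨m₁, m₂, ⟨a, ha, r₁⟩, ⟨b, hb, r₂⟩, hm⟩
    obtain ⟨k₁, w₁, n₁, r₁, hw₁, hn₁⟩ := exists_runOf r₁
    obtain ⟨k₂, w₂, n₂, r₂, hw₂, hn₂⟩ := exists_runOf r₂
    simp only [List.nil_append, zero_add] at hw₁ hw₂ hn₁ hn₂ hm
    subst hn₁ hn₂ hm hw₁ hw₂
    obtain ⟨k, hk⟩ := prod_complete h₁ h₂ hB _ le_rfl (List.mem_cons_self ..)
      (List.mem_cons_self ..) r₁ r₂ rfl
    refine ⟨_, (hF _).2 ⟨a, ha, b, hb, rfl⟩, ?_⟩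
    rw [hq]
    simpa using hk.reach [] 0

end Product

/-! ### The construction on codes -/

/-- Automata as lists, with vectors represented by their codes. -/
abbrev AutCode : Type := List ℕ × List (Edge ℕ) × ℕ × List ℕ

def prodCode (c : AutCode × AutCode) : List ℕ × List ℕ × ℕ × List ℕ :=
  let E := prodEdges (encodeVec 0) c.1.2.2.1 c.2.2.2.1 c.1.2.1 c.2.2.1
  let q := pairState (c.1.2.2.1, []) (c.2.2.2.1, [])
  let F := prodFinal c.1.2.2.2 c.2.2.2.2
  (sortDedup (prodStates E q F), sortDedup (E.map Encodable.encode), q, sortDedup F)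

theorem primrec_prodCode : Primrec prodCode := by
  unfold prodCode
  have hr₁ : Primrec fun c : AutCode × AutCode => c.1.2 := Primrec.snd.comp Primrec.fst
  have hr₂ : Primrec fun c : AutCode × AutCode => c.2.2 := Primrec.snd.comp Primrec.snd
  have hq₁ := Primrec.fst.comp (Primrec.snd.comp hr₁)
  have hq₂ := Primrec.fst.comp (Primrec.snd.comp hr₂)
  have hE := primrec_prodEdges (encodeVec 0) hq₁ hq₂ (Primrec.fst.comp hr₁)
    (Primrec.fst.comp hr₂)
  have hq := primrec_pairState.comp (hq₁.pair (Primrec.const ([] : List ℕ)))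
    (hq₂.pair (Primrec.const ([] : List ℕ)))
  have hF := primrec_prodFinal.comp (Primrec.snd.comp (Primrec.snd.comp hr₁))
    (Primrec.snd.comp (Primrec.snd.comp hr₂))
  exact (primrec_sortDedup.comp (primrec_prodStates hE hq hF)).pair
    ((primrec_sortDedup.comp (Primrec.list_map hE (Primrec.encode.comp Primrec.snd).to₂)).pair
      (hq.pair (primrec_sortDedup.comp hF)))

/-- Forget the bracketing of the label of an edge of a `RatAut`. -/
def flatEdge (e : ℕ × (List ℕ × Vec) × ℕ) : Edge Vec := (e.1, e.2.1.1, e.2.1.2, e.2.2)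

def unflatEdge (e : Edge Vec) : ℕ × (List ℕ × Vec) × ℕ := (e.1, (e.2.1, e.2.2.1), e.2.2.2)

theorem exists_autCode (B : RatAut) :
    ∃ (S F : List ℕ) (E : List (Edge Vec)), HasEdges B E ∧ (∀ x, x ∈ B.final ↔ x ∈ F) ∧
      encodeRatAut B =
        Encodable.encode ((S, E.map (Edge.map encodeVec), B.q0, F) : AutCode) := by
  obtain ⟨S, -, hS⟩ := exists_list_encode_map id B.states
  obtain ⟨F, hF, hF'⟩ := exists_list_encode_map id B.final
  obtain ⟨E, hE, hE'⟩ := exists_list_encode_map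
    (fun e => (e.1, e.2.1.1, encodeVec e.2.1.2, e.2.2)) B.edges
  rw [Multiset.map_id, List.map_id] at hS hF'
  refine ⟨S, F, E.map flatEdge, fun p u n q => ?_, hF, ?_⟩
  · rw [hE]
    simp [flatEdge]
  · simp only [encodeRatAut, Encodable.encode_prod_val, hS, hF', hE', List.map_map]
    rfl

theorem encodeRatAut_ofLists (S F : List ℕ) (E : List (Edge Vec)) (q : ℕ) :
    encodeRatAut ⟨S.toFinset, (E.map unflatEdge).toFinset, q, F.toFinset⟩ =
      Encodable.encode (sortDedup S,
        sortDedup ((E.map (Edge.map encodeVec)).map Encodable.encode), q, sortDedup F) := by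
  have hS := encode_finset_map Function.injective_id S.toFinset S fun x => List.mem_toFinset
  have hF := encode_finset_map Function.injective_id F.toFinset F fun x => List.mem_toFinset
  have hinj : Function.Injective
      (fun e : ℕ × (List ℕ × Vec) × ℕ => (e.1, e.2.1.1, encodeVec e.2.1.2, e.2.2)) := by
    rintro ⟨a, ⟨b, c⟩, d⟩ ⟨a', ⟨b', c'⟩, d'⟩ h
    simp only [Prod.mk.injEq] at h
    obtain ⟨rfl, rfl, h, rfl⟩ := h
    rw [encodeVec_injective h]
  have hE := encode_finset_map hinj (E.map unflatEdge).toFinset _ fun x => List.mem_toFinset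
  have hid : ∀ l : List ℕ, l.map Encodable.encode = l := fun l => List.map_id l
  rw [Multiset.map_id, List.map_id, hid] at hS hF
  simp only [encodeRatAut, Encodable.encode_prod_val, hS, hF, hE, List.map_map]
  rfl

/-- Given rational subsets `S, T ⊆ Γ* × ℕ^Λ`, the set
`S ⊗ T = {(w, m1 + m2) : (w, m1) ∈ S, (w, m2) ∈ T}` is rational, and an
automaton recognizing it can be effectively constructed from automata for `S`
and `T`. -/
theorem otimes_rational :
    ∃ f : ℕ → ℕ, Computable f ∧
      ∀ B1 B2 : RatAut,
        ∃ B : RatAut,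
          f (Nat.pair (encodeRatAut B1) (encodeRatAut B2)) = encodeRatAut B ∧
          RLang B = {wm : List ℕ × Vec | ∃ m1 m2 : Vec,
            (wm.1, m1) ∈ RLang B1 ∧ (wm.1, m2) ∈ RLang B2 ∧ wm.2 = m1 + m2} := by
  refine ⟨fun n => Encodable.encode
    (prodCode ((Encodable.decode (α := AutCode × AutCode) n).getD default)), ?_, ?_⟩
  · exact (Primrec.encode.comp (primrec_prodCode.comp
      (Primrec.option_getD.comp Primrec.decode (Primrec.const default)))).to_comp
  · intro B₁ B₂
    obtain ⟨S₁, F₁, E₁, h₁, hF₁, hc₁⟩ := exists_autCode B₁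
    obtain ⟨S₂, F₂, E₂, h₂, hF₂, hc₂⟩ := exists_autCode B₂
    let E := prodEdges 0 B₁.q0 B₂.q0 E₁ E₂
    let q := pairState (B₁.q0, []) (B₂.q0, [])
    let F := prodFinal F₁ F₂
    refine ⟨⟨(prodStates E q F).toFinset, (E.map unflatEdge).toFinset, q, F.toFinset⟩, ?_, ?_⟩
    · rw [encodeRatAut_ofLists, hc₁, hc₂, ← Encodable.encode_prod_val]
      beta_reduce
      simp only [Encodable.encodek, Option.getD_some, prodCode, prodEdges_map, prodStates_map]
      rfl
    · refine rLang_prod h₁ h₂ (fun p u n r => ?_) rfl fun x => ?_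
      · simp [unflatEdge, E]
      · simp [F, prodFinal, hF₁, hF₂]

end CBL
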